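/- Let μ be a compactly supported Borel probability measure on ℝ^d with μ(A) = 0 for every set A of finite H¹-measure, let p > 1, let l ≥ 0, and let Σ be a minimizer of J_p over all compact connected sets with H¹ ≤ l. Then μ(A_Σ) = 0, where A_Σ = { x ∈ ℝ^d : the set of nearest points of x in Σ has more than one element } is the ambiguous locus of Σ. -/

import Mathlib

open MeasureTheory

open Filter Topology

/-- `t ↦ t ^ p` is Lipschitz on `[0, R]` with constant `p * R ^ (p - 1)`. -/
lemma abs_rpow_sub_rpow_le {p R a b : ℝ} (hp : 1 < p) (ha : a ∈ Set.Icc 0 R)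
    (hb : b ∈ Set.Icc 0 R) : |a ^ p - b ^ p| ≤ p * R ^ (p - 1) * |a - b| := by
  refine Convex.norm_image_sub_le_of_norm_hasDerivWithin_le (f := fun t : ℝ => t ^ p)
    (fun t _ => (Real.hasDerivAt_rpow_const (Or.inr hp.le)).hasDerivWithinAt) ?_
    (convex_Icc 0 R) hb ha
  rintro t ⟨ht0, htR⟩
  rw [Real.norm_of_nonneg (by positivity)]
  gcongr

lemma tendsto_mul_norm_rpow_sub {E : Type*} [NormedAddCommGroup E] [InnerProductSpace ℝ E] {p : ℝ} (hp : 1 < p) (y v : E) :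
    Tendsto (fun n : ℕ => (n : ℝ) * (‖y + (n : ℝ)⁻¹ • v‖ ^ p - ‖y‖ ^ p)) atTop
      (𝓝 (p * ‖y‖ ^ (p - 2) * inner ℝ y v)) := by
  have h := (hasFDerivAt_norm_rpow y hp).lim v (c := fun n : ℕ => (n : ℝ)) (l := atTop) (by
    simpa using tendsto_natCast_atTop_atTop (R := ℝ))
  simpa using h

lemma continuous_infDist_rpow {E : Type*} [PseudoMetricSpace E] (S : Set E) {p : ℝ}
    (hp : 1 < p) :
    Continuous fun x => Metric.infDist x S ^ p :=
  (Metric.continuous_infDist_pt S).rpow_const fun _ => Or.inr (by linarith)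

section Translation

variable {E : Type*} [NormedAddCommGroup E] [NormedSpace ℝ E]

/-- The symmetric second difference of `infDist · S ^ p` in direction `v`, divided by the step
size `1 / n`. -/
noncomputable def secondDiff (S : Set E) (p : ℝ) (v : E) (n : ℕ) (x : E) : ℝ :=
  n * (Metric.infDist (x + (n : ℝ)⁻¹ • v) S ^ p + Metric.infDist (x + (n : ℝ)⁻¹ • -v) S ^ p
    - 2 * Metric.infDist x S ^ p)

lemma continuous_secondDiff (S : Set E) {p : ℝ} (hp : 1 < p) (v : E) (n : ℕ) :
    Continuous (secondDiff S p v n) := by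
  have h := continuous_infDist_rpow S hp
  unfold secondDiff
  exact continuous_const.mul (((h.comp (continuous_id.add continuous_const)).add
    (h.comp (continuous_id.add continuous_const))).sub (continuous_const.mul h))

lemma secondDiff_bounded_above (S : Set E) {p : ℝ} (hp : 1 < p) (v : E) {K : Set E}
    (hK : IsCompact K) : ∃ C, 0 ≤ C ∧ ∀ n, ∀ x ∈ K, secondDiff S p v n x ≤ C := by
  obtain ⟨M, hM⟩ := hK.bddAbove_image (Metric.continuous_infDist_pt S).continuousOn
  set R := max M 0 + ‖v‖ with hR
  have hR0 : 0 ≤ R := by positivity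
  refine ⟨2 * (p * R ^ (p - 1) * ‖v‖), by positivity, fun n x hx => ?_⟩
  have hxM : Metric.infDist x S ≤ max M 0 :=
    (hM (Set.mem_image_of_mem _ hx)).trans (le_max_left _ _)
  rcases Nat.eq_zero_or_pos n with rfl | hn
  · simp only [secondDiff, Nat.cast_zero, zero_mul]
    positivity
  have hn1 : (1 : ℝ) ≤ n := by exact_mod_cast hn
  have key : ∀ w : E, ‖w‖ = ‖v‖ →
      n * (Metric.infDist (x + (n : ℝ)⁻¹ • w) S ^ p - Metric.infDist x S ^ p)
        ≤ p * R ^ (p - 1) * ‖v‖ := by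
    intro w hw
    have hd : |Metric.infDist (x + (n : ℝ)⁻¹ • w) S - Metric.infDist x S| ≤ (n : ℝ)⁻¹ * ‖v‖ := by
      have := (Metric.lipschitz_infDist_pt S).dist_le_mul (x + (n : ℝ)⁻¹ • w) x
      simpa [Real.dist_eq, norm_smul, hw] using this
    have hle : (n : ℝ)⁻¹ * ‖v‖ ≤ ‖v‖ :=
      mul_le_of_le_one_left (norm_nonneg _) (inv_le_one_of_one_le₀ hn1)
    have h := abs_rpow_sub_rpow_le (R := R) hp
      (a := Metric.infDist (x + (n : ℝ)⁻¹ • w) S) (b := Metric.infDist x S)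
      ⟨Metric.infDist_nonneg, by linarith [(abs_le.1 hd).2]⟩
      ⟨Metric.infDist_nonneg, by linarith [norm_nonneg v]⟩
    calc n * (Metric.infDist (x + (n : ℝ)⁻¹ • w) S ^ p - Metric.infDist x S ^ p)
        ≤ n * (p * R ^ (p - 1) * ((n : ℝ)⁻¹ * ‖v‖)) := by
          gcongr
          exact (le_abs_self _).trans (h.trans (by gcongr))
      _ = p * R ^ (p - 1) * ‖v‖ := by field_simp
  have h₁ := key v rfl
  have h₂ := key (-v) (norm_neg v)
  unfold secondDiff
  linarith

end Translation

section NearestPoints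

variable {E : Type*} [NormedAddCommGroup E] [InnerProductSpace ℝ E]

/-- Two nearest points of `x` give an asymptotic upper bound for `secondDiff`. -/
lemma exists_tendsto_secondDiff_le {S : Set E} {p : ℝ} (hp : 1 < p) (v x : E) {σ₁ σ₂ : E}
    (h₁ : σ₁ ∈ S) (h₂ : σ₂ ∈ S) (hd₁ : dist x σ₁ = Metric.infDist x S)
    (hd₂ : dist x σ₂ = Metric.infDist x S) :
    ∃ u : ℕ → ℝ, (∀ n, secondDiff S p v n x ≤ u n) ∧
      Tendsto u atTop (𝓝 (p * Metric.infDist x S ^ (p - 2) * inner ℝ (σ₂ - σ₁) v)) := by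
  have key : ∀ (w σ : E) (n : ℕ), σ ∈ S →
      Metric.infDist (x + (n : ℝ)⁻¹ • w) S ^ p ≤ ‖x - σ + (n : ℝ)⁻¹ • w‖ ^ p := by
    intro w σ n hσ
    refine Real.rpow_le_rpow Metric.infDist_nonneg ?_ (by linarith)
    refine (Metric.infDist_le_dist_of_mem hσ).trans_eq ?_
    rw [dist_eq_norm]
    congr 1
    abel
  have ht := (tendsto_mul_norm_rpow_sub hp (x - σ₁) v).add
    (tendsto_mul_norm_rpow_sub hp (x - σ₂) (-v))
  rw [dist_eq_norm] at hd₁ hd₂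
  have hlim : p * ‖x - σ₁‖ ^ (p - 2) * inner ℝ (x - σ₁) v
      + p * ‖x - σ₂‖ ^ (p - 2) * inner ℝ (x - σ₂) (-v)
      = p * Metric.infDist x S ^ (p - 2) * inner ℝ (σ₂ - σ₁) v := by
    rw [hd₁, hd₂, inner_neg_right, inner_sub_left, inner_sub_left, inner_sub_left]
    ring
  rw [hlim] at ht
  refine ⟨_, fun n => ?_, ht⟩
  have a₁ := key v σ₁ n h₁
  have a₂ := key (-v) σ₂ n h₂
  rw [hd₁, hd₂, ← mul_add]
  unfold secondDiff
  gcongr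
  linarith

variable [MeasurableSpace E] [BorelSpace E]

/-- If translating `S` does not decrease the mean `p`-th power distance, then for almost every
point all nearest points in `S` have the same component in a given direction. -/
lemma measure_nearest_inner_lt_eq_zero {μ : Measure E} [IsProbabilityMeasure μ] {K S : Set E}
    (hK : IsCompact K) (hμK : μ Kᶜ = 0) (hS : IsCompact S) (hne : S.Nonempty) {p : ℝ} (hp : 1 < p)
    (hmin : ∀ w : E,
      (∫ x, Metric.infDist x S ^ p ∂μ) ≤ ∫ x, Metric.infDist (x + w) S ^ p ∂μ) (v : E) :
    μ {x | ∃ σ₁ ∈ S, ∃ σ₂ ∈ S, inner ℝ (σ₂ - σ₁) v < 0 ∧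
      dist x σ₁ = Metric.infDist x S ∧ dist x σ₂ = Metric.infDist x S} = 0 := by
  have haeK : ∀ᵐ x ∂μ, x ∈ K := hμK
  have hint : ∀ g : E → ℝ, Continuous g → Integrable g μ := by
    intro g hg
    have := hg.continuousOn.integrableOn_compact (μ := μ) hK
    rwa [IntegrableOn, Measure.restrict_eq_self_of_ae_mem haeK] at this
  obtain ⟨C, hC0, hC⟩ := secondDiff_bounded_above S hp v hK
  set g : ℕ → E → ENNReal := fun n x => ENNReal.ofReal (C - secondDiff S p v n x) with hg
  have hgm : ∀ n, Measurable (g n) := fun n =>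
    (continuous_const.sub (continuous_secondDiff S hp v n)).measurable.ennreal_ofReal
  have hD : ∀ n, 0 ≤ ∫ x, secondDiff S p v n x ∂μ := by
    intro n
    have hc := continuous_infDist_rpow S hp
    have hi : ∀ w : E, Integrable (fun x => Metric.infDist (x + w) S ^ p) μ := fun w =>
      hint _ (hc.comp (continuous_id.add continuous_const))
    have h₁ := hi ((n : ℝ)⁻¹ • v)
    have h₂ := hi ((n : ℝ)⁻¹ • -v)
    unfold secondDiff
    rw [integral_const_mul, integral_sub (by exact h₁.add h₂) ((hint _ hc).const_mul 2),
      integral_add h₁ h₂, integral_const_mul]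
    have := hmin ((n : ℝ)⁻¹ • v)
    have := hmin ((n : ℝ)⁻¹ • -v)
    exact mul_nonneg (Nat.cast_nonneg n) (by linarith)
  have hgint : ∀ n, ∫⁻ x, g n x ∂μ ≤ ENNReal.ofReal C := by
    intro n
    have hi := hint _ (continuous_secondDiff S hp v n)
    simp only [hg]
    rw [← ofReal_integral_eq_lintegral_ofReal (by exact (integrable_const C).sub hi)
      (by filter_upwards [haeK] with x hx using sub_nonneg.2 (hC n x hx)),
      integral_sub (integrable_const C) hi]
    refine ENNReal.ofReal_le_ofReal ?_
    simpa using hD n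
  have hlow : ∀ x, ∀ σ₁ ∈ S, ∀ σ₂ ∈ S, dist x σ₁ = Metric.infDist x S →
      dist x σ₂ = Metric.infDist x S →
      ENNReal.ofReal (C - p * Metric.infDist x S ^ (p - 2) * inner ℝ (σ₂ - σ₁) v)
        ≤ liminf (fun n => g n x) atTop := by
    intro x σ₁ h₁ σ₂ h₂ hd₁ hd₂
    obtain ⟨u, hu, hlim⟩ := exists_tendsto_secondDiff_le hp v x h₁ h₂ hd₁ hd₂
    rw [← (ENNReal.tendsto_ofReal (hlim.const_sub C)).liminf_eq]
    exact liminf_le_liminf (Eventually.of_forall fun n =>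
      ENNReal.ofReal_le_ofReal (sub_le_sub_left (hu n) C))
  have hae : (fun _ => ENNReal.ofReal C) =ᵐ[μ] fun x => liminf (fun n => g n x) atTop := by
    refine ae_eq_of_ae_le_of_lintegral_le (Eventually.of_forall fun x => ?_) (by simp)
      (Measurable.liminf hgm).aemeasurable ?_
    · obtain ⟨σ, hσ, hd⟩ := hS.exists_infDist_eq_dist hne x
      simpa using hlow x σ hσ σ hσ hd.symm hd.symm
    · refine (lintegral_liminf_le hgm).trans ?_
      simpa using liminf_le_liminf (Eventually.of_forall hgint) (f := atTop)
  refine measure_mono_null ?_ hae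
  rintro x ⟨σ₁, h₁, σ₂, h₂, hlt, hd₁, hd₂⟩ hx
  have hpos : 0 < Metric.infDist x S := by
    refine Metric.infDist_nonneg.lt_of_ne fun h0 => ?_
    rw [← h0, dist_eq_zero] at hd₁ hd₂
    subst hd₁ hd₂
    simp at hlt
  have hle := hlow x σ₁ h₁ σ₂ h₂ hd₁ hd₂
  have hx' : ENNReal.ofReal C = liminf (fun n => g n x) atTop := hx
  rw [← hx', ENNReal.ofReal_le_ofReal_iff hC0] at hle
  have : p * Metric.infDist x S ^ (p - 2) * inner ℝ (σ₂ - σ₁) v < 0 :=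
    mul_neg_of_pos_of_neg (by positivity) hlt
  linarith

end NearestPoints

/-- minimizers of J_p over S_l have μ-null ambiguous locus,
    assuming μ vanishes on sets of finite H¹-measure. -/
theorem stmt15 (d : ℕ) (μ : Measure (EuclideanSpace ℝ (Fin d))) [IsProbabilityMeasure μ]
    (hcs : ∃ K : Set (EuclideanSpace ℝ (Fin d)), IsCompact K ∧ μ Kᶜ = 0)
    (hμ : ∀ A : Set (EuclideanSpace ℝ (Fin d)), μH[1] A < ⊤ → μ A = 0)
    (p : ℝ) (hp : 1 < p) (l : ℝ) (hl : 0 ≤ l)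
    (S : Set (EuclideanSpace ℝ (Fin d))) (hSc : IsCompact S) (hSconn : IsConnected S)
    (hSl : μH[1] S ≤ ENNReal.ofReal l)
    (hmin : ∀ T : Set (EuclideanSpace ℝ (Fin d)), IsCompact T → IsConnected T →
      μH[1] T ≤ ENNReal.ofReal l →
      (∫ x, Metric.infDist x S ^ p ∂μ) ≤ ∫ x, Metric.infDist x T ^ p ∂μ) :
    μ {x | ∃ σ₁ ∈ S, ∃ σ₂ ∈ S, σ₁ ≠ σ₂ ∧
        dist x σ₁ = Metric.infDist x S ∧ dist x σ₂ = Metric.infDist x S} = 0 := by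
  obtain ⟨K, hK, hμK⟩ := hcs
  have htrans : ∀ w : EuclideanSpace ℝ (Fin d),
      (∫ x, Metric.infDist x S ^ p ∂μ) ≤ ∫ x, Metric.infDist (x + w) S ^ p ∂μ := by
    intro w
    have hc : Continuous fun y : EuclideanSpace ℝ (Fin d) => y + -w :=
      continuous_id.add continuous_const
    have hiso : Isometry fun y : EuclideanSpace ℝ (Fin d) => y + -w :=
      (IsometryEquiv.addRight (-w)).isometry
    refine (hmin ((fun y => y + -w) '' S) (hSc.image hc) (hSconn.image _ hc.continuousOn)
      ?_).trans_eq ?_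
    · rwa [hiso.hausdorffMeasure_image (Or.inl zero_le_one)]
    · refine integral_congr_ae (Eventually.of_forall fun x => ?_)
      have h := Metric.infDist_image hiso (x := x + w) (t := S)
      simp only [add_neg_cancel_right] at h
      simp only [h]
  have hdir := measure_nearest_inner_lt_eq_zero hK hμK hSc hSconn.nonempty hp htrans
  refine measure_mono_null ?_
    (measure_iUnion_null fun i : Fin d => hdir (EuclideanSpace.single i (1 : ℝ)))
  rintro x ⟨σ₁, h₁, σ₂, h₂, hne, hd₁, hd₂⟩
  obtain ⟨i, hi⟩ : ∃ i, σ₁ i ≠ σ₂ i := by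
    by_contra! h
    exact hne (PiLp.ext h)
  refine Set.mem_iUnion.2 ⟨i, ?_⟩
  rcases hi.lt_or_gt with h | h
  · exact ⟨σ₂, h₂, σ₁, h₁, by simpa [EuclideanSpace.inner_single_right] using h, hd₂, hd₁⟩
  · exact ⟨σ₁, h₁, σ₂, h₂, by simpa [EuclideanSpace.inner_single_right] using h, hd₁, hd₂⟩
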